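/- For every real s ∈ [1, 2], one has g(d) = 1 + d/s + 2·sin((d·(1 + 1/s) + s − 1)/2) ≤ 1 + 2·√(1 − 1/(s+1)²) + (2·arccos(−1/(s+1)) − s + 1)/(s + 1) for all d ∈ [s(π − s + 1)/(s + 1), s(2π − s + 1)/(s + 1)], with equality at d = s·(2·arccos(−1/(s+1)) − s + 1)/(s + 1). (This is the worst-case evacuation time of the Both-to-the-Same-Point strategy when the angle between the two robots at the moment the exit is found is between π and 2π.) -/

import Mathlib

open Real

lemma sin_tangent (a x : ℝ) (ha : a ∈ Set.Icc 0 Real.pi) (hx : x ∈ Set.Icc 0 Real.pi) :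
    Real.sin x ≤ Real.sin a + Real.cos a * (x - a) := by
  have hc := strictConcaveOn_sin_Icc.concaveOn
  rcases lt_trichotomy x a with h | h | h
  · have := hc.le_slope_of_hasDerivAt hx ha h (Real.hasDerivAt_sin a)
    rw [slope_def_field, le_div_iff₀ (by linarith)] at this
    linarith
  · subst h; simp
  · have := hc.slope_le_of_hasDerivAt ha hx h (Real.hasDerivAt_sin a)
    rw [slope_def_field, div_le_iff₀ (by linarith)] at this
    linarith

/-- BSP strategy, angle between π and 2π case: for `s ∈ [1,2]` and all
`d ∈ [s(π − s + 1)/(s + 1), s(2π − s + 1)/(s + 1)]`,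
`g(d) = 1 + d/s + 2·sin((d·(1 + 1/s) + s − 1)/2) ≤ BSP(s)`, with equality at
`d = s·(2·arccos(−1/(s+1)) − s + 1)/(s + 1)`, where
`BSP(s) = 1 + 2·√(1 − 1/(s+1)²) + (2·arccos(−1/(s+1)) − s + 1)/(s + 1)`. -/
theorem bsp_angle_gt_pi (s : ℝ) (hs : s ∈ Set.Icc (1 : ℝ) 2) :
    (∀ d ∈ Set.Icc (s * (Real.pi - s + 1) / (s + 1)) (s * (2 * Real.pi - s + 1) / (s + 1)),
      1 + d / s + 2 * Real.sin ((d * (1 + 1 / s) + s - 1) / 2) ≤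
        1 + 2 * Real.sqrt (1 - 1 / (s + 1) ^ 2) +
          (2 * Real.arccos (-1 / (s + 1)) - s + 1) / (s + 1)) ∧
    1 + (s * (2 * Real.arccos (-1 / (s + 1)) - s + 1) / (s + 1)) / s +
        2 * Real.sin
          (((s * (2 * Real.arccos (-1 / (s + 1)) - s + 1) / (s + 1)) * (1 + 1 / s) + s - 1) / 2) =
      1 + 2 * Real.sqrt (1 - 1 / (s + 1) ^ 2) +
        (2 * Real.arccos (-1 / (s + 1)) - s + 1) / (s + 1) := by
  obtain ⟨h1, h2⟩ := hs
  have hs0 : 0 < s := by linarith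
  have hs1 : 0 < s + 1 := by linarith
  have hle : 1 / (s + 1) ≤ 1 := by rw [div_le_one hs1]; linarith
  have hpos : 0 < 1 / (s + 1) := by positivity
  have hneg : -1 / (s + 1) = -(1 / (s + 1)) := by ring
  have hcos : Real.cos (Real.arccos (-1 / (s + 1))) = -1 / (s + 1) :=
    Real.cos_arccos (by linarith) (by linarith)
  have hsin : Real.sin (Real.arccos (-1 / (s + 1))) = Real.sqrt (1 - 1 / (s + 1) ^ 2) := by
    rw [Real.sin_arccos]; congr 2; rw [div_pow]; norm_num
  have ha0 := Real.arccos_nonneg (-1 / (s + 1))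
  have ha1 := Real.arccos_le_pi (-1 / (s + 1))
  rw [← hsin]
  generalize Real.arccos (-1 / (s + 1)) = a at *
  constructor
  · rintro d ⟨hd1, hd2⟩
    rw [div_le_iff₀ hs1] at hd1
    rw [le_div_iff₀ hs1] at hd2
    obtain ⟨x, hx⟩ : ∃ x, x = (d * (1 + 1 / s) + s - 1) / 2 := ⟨_, rfl⟩
    rw [← hx]
    have hd : d = s * (2 * x - s + 1) / (s + 1) := by
      rw [hx]; field_simp; ring
    have hd' : d * (s + 1) = s * (2 * x - s + 1) := by
      rw [hd]; field_simp
    rw [hd'] at hd1 hd2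
    have hx1 := le_of_mul_le_mul_left hd1 hs0
    have hx2 := le_of_mul_le_mul_left hd2 hs0
    have := sin_tangent a x ⟨ha0, ha1⟩ ⟨by linarith [Real.pi_pos], by linarith⟩
    rw [hcos] at this
    have e : d / s = (2 * a - s + 1) / (s + 1) - 2 * (-1 / (s + 1) * (x - a)) := by
      rw [hd]; field_simp; ring
    rw [e]; linarith
  · have e : ((s * (2 * a - s + 1) / (s + 1)) * (1 + 1 / s) + s - 1) / 2 = a := by
      field_simp; ring
    rw [e]
    have e2 : s * (2 * a - s + 1) / (s + 1) / s = (2 * a - s + 1) / (s + 1) := by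
      field_simp
    rw [e2]; ring
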